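/- arXiv:2410.07735 — 2 statements merged into one kernel-verified Lean document; each statement's English description precedes it below -/
import Mathlib

section
/- Let $\kappa > 0$ and $\beta > \kappa$ be real numbers, and define for $b > 0$ the function $\sigma_\infty^2(b) = \frac{1}{2\kappa}\Big[1 - \frac{\beta - \kappa}{\beta}\Big(\frac{\sqrt{b^2 + \kappa^2} - \kappa}{b}\Big)^2\Big]$. Then $\sigma_\infty^2$ is strictly decreasing on $(0, \infty)$. -/
theorem sq_sqrt_add_sq_sub_div {κ b : ℝ} (hκ : 0 < κ) (hb : 0 < b) :
    ((Real.sqrt (b ^ 2 + κ ^ 2) - κ) / b) ^ 2 =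
      1 - 2 * κ / (Real.sqrt (b ^ 2 + κ ^ 2) + κ) := by
  have hs : Real.sqrt (b ^ 2 + κ ^ 2) ^ 2 = b ^ 2 + κ ^ 2 := Real.sq_sqrt (by positivity)
  have hpos : 0 < Real.sqrt (b ^ 2 + κ ^ 2) + κ := by positivity
  generalize Real.sqrt (b ^ 2 + κ ^ 2) = s at hs hpos ⊢
  rw [div_pow, one_sub_div hpos.ne', div_eq_div_iff (by positivity) hpos.ne']
  linear_combination (s - κ) * hs

/-- the stationary variance of the optimally controlled
consumption process is strictly decreasing in the precision `b`. -/
theorem stmt_6 (κ β : ℝ) (hκ : 0 < κ) (hβ : κ < β) :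
    StrictAntiOn
      (fun b : ℝ =>
        1 / (2 * κ) *
          (1 - (β - κ) / β * ((Real.sqrt (b ^ 2 + κ ^ 2) - κ) / b) ^ 2))
      (Set.Ioi 0) := by
  intro a (ha : 0 < a) b (hb : 0 < b) hab
  have hβ₀ : 0 < β := hκ.trans hβ
  have hc : 0 < (β - κ) / β := div_pos (sub_pos.2 hβ) hβ₀
  dsimp only
  rw [sq_sqrt_add_sq_sub_div hκ ha, sq_sqrt_add_sq_sub_div hκ hb]
  gcongr
end

section
/- Let $k_I, r, \eta > 0$ and $\underline v < \bar v$ be real numbers, set $\Delta v = \bar v - \underline v$, and define $F(z) = \tfrac12 k_I z + \tfrac{r\eta}{2}\big(\frac{\Delta v}{z - \underline v} - 1\big)$ for $z \in (\underline v, \bar v]$. Then: (i) if $k_I \Delta v \le r \eta$, the unique minimizer of $F$ on $(\underline v, \bar v]$ is $z^* = \bar v$; (ii) if $k_I \Delta v > r \eta$, the unique minimizer of $F$ on $(\underline v, \bar v]$ is $z^* = \underline v + \sqrt{r \eta \Delta v / k_I}$, which lies in the open interval $(\underline v, \bar v)$. -/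
/-- minimization of the Sender's reduced objective
`F(z) = k_I z / 2 + (rη/2)(Δv/(z - v̲) - 1)` over `(v̲, v̄]`. -/
theorem stmt_11 (kI r η vlo vhi : ℝ)
    (hkI : 0 < kI) (hr : 0 < r) (hη : 0 < η) (hv : vlo < vhi)
    (Δv : ℝ) (hΔv : Δv = vhi - vlo)
    (F : ℝ → ℝ)
    (hF : ∀ z : ℝ, F z = 1 / 2 * kI * z + r * η / 2 * (Δv / (z - vlo) - 1)) :
    (kI * Δv ≤ r * η →
      (∀ z ∈ Set.Ioc vlo vhi, F vhi ≤ F z) ∧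
      (∀ z ∈ Set.Ioc vlo vhi, F z = F vhi → z = vhi)) ∧
    (r * η < kI * Δv →
      (vlo + Real.sqrt (r * η * Δv / kI) ∈ Set.Ioo vlo vhi) ∧
      (∀ z ∈ Set.Ioc vlo vhi, F (vlo + Real.sqrt (r * η * Δv / kI)) ≤ F z) ∧
      (∀ z ∈ Set.Ioc vlo vhi, F z = F (vlo + Real.sqrt (r * η * Δv / kI)) →
        z = vlo + Real.sqrt (r * η * Δv / kI))) := by
  have D_pos : 0 < Δv := by linarith
  refine ⟨fun h => ?_, fun h => ?_⟩
  · have key : ∀ z ∈ Set.Ioc vlo vhi,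
        F z - F vhi = (vhi - z) * (r * η - kI * (z - vlo)) / (2 * (z - vlo)) := by
      rintro z ⟨hz, -⟩
      have z_sub_ne : z - vlo ≠ 0 := (sub_pos.2 hz).ne'
      rw [hF, hF, ← hΔv, div_self D_pos.ne']
      field_simp
      rw [hΔv]
      ring
    have lt_of_ne : ∀ z ∈ Set.Ioc vlo vhi, z ≠ vhi → F vhi < F z := by
      intro z hz hne
      have z_lt : z < vhi := lt_of_le_of_ne hz.2 hne
      have z_sub_pos : 0 < z - vlo := sub_pos.2 hz.1
      have slope_pos : 0 < r * η - kI * (z - vlo) := by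
        have : kI * (z - vlo) < kI * Δv := mul_lt_mul_of_pos_left (by linarith) hkI
        linarith
      have diff_pos : 0 < F z - F vhi := by
        rw [key z hz]
        exact div_pos (mul_pos (sub_pos.2 z_lt) slope_pos) (by positivity)
      linarith
    refine ⟨fun z hz => ?_, fun z hz heq => ?_⟩
    · rcases eq_or_ne z vhi with rfl | hne
      · exact le_rfl
      · exact (lt_of_ne z hz hne).le
    · by_contra hne
      exact (lt_of_ne z hz hne).ne' heq
  · have arg_pos : 0 < r * η * Δv / kI := by positivity
    have s_pos := Real.sqrt_pos.2 arg_pos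
    have s_sq : r * η * Δv = kI * Real.sqrt (r * η * Δv / kI) ^ 2 := by
      rw [Real.sq_sqrt arg_pos.le]
      field_simp
    have s_lt : Real.sqrt (r * η * Δv / kI) < Δv := by
      rw [Real.sqrt_lt' D_pos, div_lt_iff₀ hkI]
      nlinarith
    generalize Real.sqrt (r * η * Δv / kI) = s at *
    have key : ∀ z ∈ Set.Ioc vlo vhi,
        F z - F (vlo + s) = kI * (z - (vlo + s)) ^ 2 / (2 * (z - vlo)) := by
      rintro z ⟨hz, -⟩
      have z_sub_ne : z - vlo ≠ 0 := (sub_pos.2 hz).ne'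
      rw [hF, hF, add_sub_cancel_left]
      field_simp
      linear_combination (s - (z - vlo)) * s_sq
    refine ⟨⟨by linarith, by linarith⟩, fun z hz => ?_, fun z hz heq => ?_⟩
    · have z_sub_pos : 0 < z - vlo := sub_pos.2 hz.1
      rw [← sub_nonneg, key z hz]
      positivity
    · have z_sub_pos : 0 < z - vlo := sub_pos.2 hz.1
      have hzero := key z hz
      rw [heq, sub_self, eq_comm, div_eq_zero_iff] at hzero
      have sq_zero : (z - (vlo + s)) ^ 2 = 0 := by
        rcases hzero with h0 | h0
        · exact (mul_eq_zero.1 h0).resolve_left hkI.ne'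
        · linarith
      exact sub_eq_zero.1 (pow_eq_zero_iff two_ne_zero |>.1 sq_zero)
end
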